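/- Let (H, ⟨·,·⟩) be a real inner product space and let a, x, y ∈ H \ {0}. If there exist δ₁, δ₂ ∈ (0, 1] with δ₁ + δ₂ ≥ 1 such that ⟨x,a⟩/(‖x‖‖a‖) ≥ δ₁ and ⟨y,a⟩/(‖y‖‖a‖) ≥ δ₂, then ⟨x,y⟩/(‖x‖‖y‖) ≥ (1/2)(δ₁ + δ₂)² − 3/2. -/

import Mathlib

open RealInnerProductSpace

/-- For unit vectors, Cauchy-Schwarz applied to `u + v` and `e` bounds `⟪u, v⟫` from below. -/
lemma sq_inner_add_inner_le_of_norm_eq_one {H : Type*} [NormedAddCommGroup H]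
    [InnerProductSpace ℝ H] {e u v : H} (he : ‖e‖ = 1) (hu : ‖u‖ = 1) (hv : ‖v‖ = 1) :
    (⟪u, e⟫ + ⟪v, e⟫) ^ 2 ≤ 2 + 2 * ⟪u, v⟫ := by
  have h := abs_real_inner_le_norm (u + v) e
  rw [he, mul_one, inner_add_left] at h
  calc (⟪u, e⟫ + ⟪v, e⟫) ^ 2 ≤ ‖u + v‖ ^ 2 := sq_le_sq.mpr (by rwa [abs_norm])
    _ = 2 + 2 * ⟪u, v⟫ := by rw [norm_add_sq_real, hu, hv]; ring

lemma inner_inv_norm_smul {H : Type*} [NormedAddCommGroup H] [InnerProductSpace ℝ H] (x y : H) :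
    ⟪‖x‖⁻¹ • x, ‖y‖⁻¹ • y⟫ = ⟪x, y⟫ / (‖x‖ * ‖y‖) := by
  rw [real_inner_smul_left, real_inner_smul_right, div_eq_mul_inv, mul_inv]
  ring

theorem precupanu_delta_bound {H : Type*} [NormedAddCommGroup H] [InnerProductSpace ℝ H]
    (a x y : H) (ha : a ≠ 0) (hx : x ≠ 0) (hy : y ≠ 0)
    (δ₁ δ₂ : ℝ) (hδ₁ : δ₁ ∈ Set.Ioc (0 : ℝ) 1) (hδ₂ : δ₂ ∈ Set.Ioc (0 : ℝ) 1)
    (hsum : 1 ≤ δ₁ + δ₂)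
    (h1 : ⟪x, a⟫ / (‖x‖ * ‖a‖) ≥ δ₁) (h2 : ⟪y, a⟫ / (‖y‖ * ‖a‖) ≥ δ₂) :
    ⟪x, y⟫ / (‖x‖ * ‖y‖) ≥ (1 / 2) * (δ₁ + δ₂) ^ 2 - 3 / 2 := by
  have norm_one {z : H} (hz : z ≠ 0) : ‖‖z‖⁻¹ • z‖ = 1 := by
    rw [norm_smul, norm_inv, norm_norm, inv_mul_cancel₀ (norm_ne_zero_iff.mpr hz)]
  have h := sq_inner_add_inner_le_of_norm_eq_one (norm_one ha) (norm_one hx) (norm_one hy)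
  simp only [inner_inv_norm_smul] at h
  have hle := pow_le_pow_left₀ (zero_le_one.trans hsum) (add_le_add h1 h2) 2
  linarith
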